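/- Let (X, d) be a metric space equipped with a Borel measure μ such that every ball of positive radius has positive and finite measure. Let p₁, p₂ ∈ X, let b = d(p₁, p₂), and let n be a positive integer. Assume the volume comparison property: for every r > b, μ(B(p₁, r+b)) ≤ ((r+b)/(r−b))^(2n) · μ(B(p₁, r−b)). Let f : X → [0, ∞) be a Borel measurable function. If r² · ⨍_{B(p₁,r)} f dμ → ∞ as r → ∞, then also r² · ⨍_{B(p₂,r)} f dμ → ∞ as r → ∞. -/

import Mathlib

open MeasureTheory Metric Filter

/-- If `s ⊆ t ⊆ u` and `μ u ≤ C * μ s`, then the average of a nonnegative function over `s` is at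
most `C` times its average over `t`. -/
theorem setAverage_le_mul_setAverage_of_subset {X : Type*} [MeasurableSpace X] {μ : Measure X}
    {s t u : Set X} {f : X → ℝ} {C : ℝ} (hst : s ⊆ t) (htu : t ⊆ u)
    (hs : 0 < μ.real s) (hu : μ u ≠ ⊤) (hC : μ.real u ≤ C * μ.real s)
    (hf0 : ∀ x, 0 ≤ f x) (hfu : IntegrableOn f u μ) :
    ⨍ x in s, f x ∂μ ≤ C * ⨍ x in t, f x ∂μ := by
  have hμst : μ.real s ≤ μ.real t :=
    measureReal_mono hst (ne_top_of_le_ne_top hu (measure_mono htu))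
  have hμtu : μ.real t ≤ μ.real u := measureReal_mono htu hu
  have ht : 0 < μ.real t := hs.trans_le hμst
  have hint : ∫ x in s, f x ∂μ ≤ ∫ x in t, f x ∂μ :=
    setIntegral_mono_set (hfu.mono_set htu) (ae_of_all _ hf0) (LE.le.eventuallyLE hst)
  have hint0 : 0 ≤ ∫ x in t, f x ∂μ := integral_nonneg hf0
  rw [setAverage_eq, setAverage_eq, smul_eq_mul, smul_eq_mul, inv_mul_eq_div, inv_mul_eq_div,
    ← mul_div_assoc, div_le_div_iff₀ hs ht]
  calc (∫ x in s, f x ∂μ) * μ.real t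
      ≤ (∫ x in t, f x ∂μ) * (C * μ.real s) := by
        gcongr
        exact hμtu.trans hC
    _ = C * (∫ x in t, f x ∂μ) * μ.real s := by ring

/-- Base-point independence of the limit `lim r² ⨍_{B(p,r)} f` under the
Bishop–Gromov type volume comparison (infinite limit case). -/
theorem basepoint_independence_infinite
    {X : Type*} [MetricSpace X] [MeasurableSpace X] [BorelSpace X]
    (μ : Measure X)
    (hballs : ∀ (p : X) (r : ℝ), 0 < r → 0 < μ (ball p r) ∧ μ (ball p r) < ⊤)
    (p₁ p₂ : X) (b : ℝ) (hb : b = dist p₁ p₂) (n : ℕ) (hn : 0 < n)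
    (hcomp : ∀ r : ℝ, b < r →
      μ (ball p₁ (r + b)) ≤ ENNReal.ofReal (((r + b) / (r - b)) ^ (2 * n)) * μ (ball p₁ (r - b)))
    (f : X → ℝ) (hf : Measurable f) (hf0 : ∀ x, 0 ≤ f x)
    (hlim : Tendsto (fun r : ℝ => r ^ 2 * ⨍ x in ball p₁ r, f x ∂μ) atTop atTop) :
    Tendsto (fun r : ℝ => r ^ 2 * ⨍ x in ball p₂ r, f x ∂μ) atTop atTop := by
  have hb0 : 0 ≤ b := hb ▸ dist_nonneg
  have hlower : Tendsto
      (fun r : ℝ => (2 ^ (2 * n))⁻¹ * ((r - b) ^ 2 * ⨍ x in ball p₁ (r - b), f x ∂μ))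
      atTop atTop :=
    (hlim.comp (tendsto_atTop_add_const_right _ (-b) tendsto_id)).const_mul_atTop (by positivity)
  refine tendsto_atTop_mono' _ ?_ hlower
  have hpos := (hlim.comp (tendsto_atTop_add_const_right _ b tendsto_id)).eventually_gt_atTop 0
  filter_upwards [hpos, eventually_gt_atTop b, eventually_ge_atTop (3 * b)] with r hr hbr h3
  have hrb : 0 < r - b := sub_pos.2 hbr
  -- A non-integrable function would have Bochner average zero.
  have hint : IntegrableOn f (ball p₁ (r + b)) μ := by
    by_contra h
    simp [setAverage_eq, integral_undef h] at hr
  obtain ⟨hs, hs'⟩ := hballs p₁ (r - b) hrb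
  obtain ⟨-, hu⟩ := hballs p₁ (r + b) (by linarith)
  have hratio : ((r + b) / (r - b)) ^ (2 * n) ≤ 2 ^ (2 * n) := by
    have h0 : 0 ≤ (r + b) / (r - b) := div_nonneg (by linarith) hrb.le
    gcongr
    rw [div_le_iff₀ hrb]
    linarith
  have hC : μ.real (ball p₁ (r + b)) ≤ 2 ^ (2 * n) * μ.real (ball p₁ (r - b)) := by
    have h := ENNReal.toReal_mono (ENNReal.mul_ne_top ENNReal.ofReal_ne_top hs'.ne) (hcomp r hbr)
    rw [ENNReal.toReal_mul, ENNReal.toReal_ofReal ((even_two_mul n).pow_nonneg _)] at h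
    exact h.trans (mul_le_mul_of_nonneg_right hratio measureReal_nonneg)
  have havg := setAverage_le_mul_setAverage_of_subset
    (ball_subset_ball' (x := p₁) (y := p₂) (ε₁ := r - b) (ε₂ := r) (by linarith))
    (ball_subset_ball' (by rw [dist_comm, ← hb]))
    (ENNReal.toReal_pos hs.ne' hs'.ne) hu.ne hC hf0 hint
  rw [inv_mul_le_iff₀ (by positivity)]
  calc (r - b) ^ 2 * ⨍ x in ball p₁ (r - b), f x ∂μ
      ≤ r ^ 2 * (2 ^ (2 * n) * ⨍ x in ball p₂ r, f x ∂μ) := by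
        refine mul_le_mul (pow_le_pow_left₀ hrb.le (by linarith) 2) havg ?_ (sq_nonneg r)
        exact integral_nonneg hf0
    _ = 2 ^ (2 * n) * (r ^ 2 * ⨍ x in ball p₂ r, f x ∂μ) := by ring
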